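/- arXiv:2502.14738 — 6 statements merged into one kernel-verified Lean document; each statement's English description precedes it below -/
import Mathlib

section
/- Assume the penalties are distinct, i.e., ξ(θ_i) ≠ ξ(θ_j) whenever θ_i ≠ θ_j. Then for all subsets A, B ⊆ D, if f({a} ∪ B) − f(B) = 0 for every a ∈ A \ B, then f(A ∪ B) − f(B) = 0. -/
open Finset

/-- The observationally equivalent set of an information set `I`:
`F(I) = ⋂_{i ∈ I} F(i)`, with `F(∅) = Θ`. -/
def obsEq {Θ D : Type*} [Fintype Θ] [DecidableEq Θ] (F : D → Finset Θ)
    (I : Finset D) : Finset Θ := I.inf F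

/-- The maximum-penalty objective `f(I) = 1 - max_{θ ∈ F(I)} ξ(θ)`. -/
noncomputable def maxPenObj {Θ D : Type*} [Fintype Θ] [DecidableEq Θ]
    (ξ : Θ → ℝ) (F : D → Finset Θ) (I : Finset D) : ℝ :=
  1 - sSup (Set.image ξ (↑(obsEq F I) : Set Θ))

theorem mem_obsEq_iff {Θ D : Type*} [Fintype Θ] [DecidableEq Θ] (F : D → Finset Θ)
    (I : Finset D) (θ : Θ) : θ ∈ obsEq F I ↔ ∀ i ∈ I, θ ∈ F i := by
  unfold obsEq
  rw [← Finset.singleton_subset_iff, Finset.le_inf_iff]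
  simp

theorem maxPenObj_spec {Θ D : Type*} [Fintype Θ] [DecidableEq Θ] (θp : Θ)
    (F : D → Finset Θ) (hF : ∀ i : D, θp ∈ F i) (ξ : Θ → ℝ) (I : Finset D) :
    ∃ θ, (∀ i ∈ I, θ ∈ F i) ∧ (∀ η, (∀ i ∈ I, η ∈ F i) → ξ η ≤ ξ θ) ∧
      maxPenObj ξ F I = 1 - ξ θ := by
  obtain ⟨θ, h1, h2⟩ := Finset.exists_max_image (obsEq F I) ξ
    ⟨θp, (mem_obsEq_iff F I θp).2 fun i _ => hF i⟩
  refine ⟨θ, (mem_obsEq_iff F I θ).1 h1,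
    fun η hη => h2 η ((mem_obsEq_iff F I η).2 hη), ?_⟩
  have hg : IsGreatest (Set.image ξ (↑(obsEq F I) : Set Θ)) (ξ θ) := by
    refine ⟨⟨θ, h1, rfl⟩, ?_⟩
    rintro _ ⟨η, hη, rfl⟩
    exact h2 η hη
  unfold maxPenObj
  rw [hg.csSup_eq]

theorem stmt1 {Θ D : Type*} [Fintype Θ] [DecidableEq Θ] [Fintype D] [DecidableEq D]
    (hΘ : 2 ≤ Fintype.card Θ) (θp : Θ)
    (F : D → Finset Θ) (hF : ∀ i : D, θp ∈ F i)
    (ξ : Θ → ℝ) (hξ0 : ∀ θ, 0 ≤ ξ θ) (hξ1 : ∀ θ, ξ θ ≤ 1) (hξp : ξ θp = 0)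
    (hdist : ∀ θi θj : Θ, θi ≠ θj → ξ θi ≠ ξ θj)
    (A B : Finset D)
    (h : ∀ a ∈ A \ B, maxPenObj ξ F (insert a B) - maxPenObj ξ F B = 0) :
    maxPenObj ξ F (A ∪ B) - maxPenObj ξ F B = 0 := by
  obtain ⟨θ, h1, h2, h3⟩ := maxPenObj_spec θp F hF ξ B
  obtain ⟨η, g1, g2, g3⟩ := maxPenObj_spec θp F hF ξ (A ∪ B)
  have hA : ∀ i ∈ A ∪ B, θ ∈ F i := by
    intro i hi
    by_cases hB : i ∈ B
    · exact h1 i hB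
    · have hiA : i ∈ A := (Finset.mem_union.1 hi).resolve_right hB
      have hh := h i (Finset.mem_sdiff.2 ⟨hiA, hB⟩)
      obtain ⟨ζ, k1, k2, k3⟩ := maxPenObj_spec θp F hF ξ (insert i B)
      have e : ζ = θ := by
        by_contra hne
        apply hdist ζ θ hne
        linarith
      exact e ▸ k1 i (Finset.mem_insert_self i B)
  have l1 := g2 θ hA
  have l2 := h2 η fun i hi => g1 i (Finset.mem_union_right A hi)
  linarith
end

section
/- Assume the penalties are distinct, i.e., ξ(θ_i) ≠ ξ(θ_j) whenever θ_i ≠ θ_j, and define ξ̲ = min_{θ_i ≠ θ_j} |ξ(θ_i) − ξ(θ_j)| and ξ̄ = max_{θ_i ≠ θ_j} |ξ(θ_i) − ξ(θ_j)|. Then f is approximately submodular with submodularity ratio at least γ = ξ̲/ξ̄; that is, for all subsets A, B ⊆ D, ∑_{a ∈ A \ B} (f({a} ∪ B) − f(B)) ≥ (ξ̲/ξ̄) · (f(A ∪ B) − f(B)). -/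
open Finset

lemma maxPen_attained {Θ D : Type*} [Fintype Θ] [DecidableEq Θ]
    (θp : Θ) (F : D → Finset Θ) (hF : ∀ i : D, θp ∈ F i) (ξ : Θ → ℝ) (I : Finset D) :
    ∃ θ, (∀ i ∈ I, θ ∈ F i) ∧ maxPenObj ξ F I = 1 - ξ θ ∧
      ∀ η, (∀ i ∈ I, η ∈ F i) → ξ η ≤ ξ θ := by
  have hmem : ∀ η, η ∈ obsEq F I ↔ ∀ i ∈ I, η ∈ F i := by
    intro η
    unfold obsEq
    exact Finset.mem_inf
  obtain ⟨θ, h1, h2⟩ := Finset.exists_max_image (obsEq F I) ξ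
    ⟨θp, (hmem θp).2 fun i _ => hF i⟩
  refine ⟨θ, (hmem θ).1 h1, ?_, fun η hη => h2 η ((hmem η).2 hη)⟩
  unfold maxPenObj
  have : IsGreatest (Set.image ξ (↑(obsEq F I) : Set Θ)) (ξ θ) := by
    refine ⟨⟨θ, by simpa using h1, rfl⟩, ?_⟩
    rintro _ ⟨η, hη, rfl⟩
    exact h2 η (by simpa using hη)
  rw [this.csSup_eq]

theorem stmt2 {Θ D : Type*} [Fintype Θ] [DecidableEq Θ] [Fintype D] [DecidableEq D]
    (hΘ : 2 ≤ Fintype.card Θ) (θp : Θ)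
    (F : D → Finset Θ) (hF : ∀ i : D, θp ∈ F i)
    (ξ : Θ → ℝ) (hξ0 : ∀ θ, 0 ≤ ξ θ) (hξ1 : ∀ θ, ξ θ ≤ 1) (hξp : ξ θp = 0)
    (hdist : ∀ θi θj : Θ, θi ≠ θj → ξ θi ≠ ξ θj) :
    ∀ A B : Finset D,
      ∑ a ∈ A \ B, (maxPenObj ξ F (insert a B) - maxPenObj ξ F B) ≥
        (sInf {x : ℝ | ∃ θi θj : Θ, θi ≠ θj ∧ x = |ξ θi - ξ θj|} /
         sSup {x : ℝ | ∃ θi θj : Θ, θi ≠ θj ∧ x = |ξ θi - ξ θj|}) *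
          (maxPenObj ξ F (A ∪ B) - maxPenObj ξ F B) := by
  intro A B
  set S : Set ℝ := {x : ℝ | ∃ θi θj : Θ, θi ≠ θj ∧ x = |ξ θi - ξ θj|} with hS
  have hbelow : BddBelow S := ⟨0, by rintro _ ⟨i, j, _, rfl⟩; exact abs_nonneg _⟩
  have habove : BddAbove S := ⟨1, by
    rintro _ ⟨i, j, _, rfl⟩
    rw [abs_le]
    constructor <;> linarith [hξ0 i, hξ0 j, hξ1 i, hξ1 j]⟩
  have hinf0 : 0 ≤ sInf S := Real.sInf_nonneg (by
    rintro _ ⟨i, j, _, rfl⟩; exact abs_nonneg _)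
  obtain ⟨b, hb, hfb, hbmax⟩ := maxPen_attained θp F hF ξ B
  obtain ⟨u, hu, hfu, humax⟩ := maxPen_attained θp F hF ξ (A ∪ B)
  have hterm : ∀ a ∈ A \ B, 0 ≤ maxPenObj ξ F (insert a B) - maxPenObj ξ F B := by
    intro a _
    obtain ⟨c, hc, hfc, -⟩ := maxPen_attained θp F hF ξ (insert a B)
    have := hbmax c fun i hi => hc i (Finset.mem_insert_of_mem hi)
    rw [hfc, hfb]; linarith
  have hub : ξ u ≤ ξ b := hbmax u fun i hi => hu i (Finset.mem_union_right _ hi)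
  by_cases hbu : ∀ i ∈ A ∪ B, b ∈ F i
  · have h0 : maxPenObj ξ F (A ∪ B) - maxPenObj ξ F B = 0 := by
      rw [hfu, hfb]; linarith [humax b hbu]
    rw [h0, mul_zero]
    exact Finset.sum_nonneg hterm
  · push Not at hbu
    obtain ⟨a, haU, hab⟩ := hbu
    have haB : a ∉ B := fun h => hab (hb a h)
    have haA : a ∈ A := (Finset.mem_union.1 haU).resolve_right haB
    obtain ⟨c, hc, hfc, -⟩ := maxPen_attained θp F hF ξ (insert a B)
    have hcb : ξ c ≤ ξ b := hbmax c fun i hi => hc i (Finset.mem_insert_of_mem hi)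
    have hne : b ≠ c := fun h => hab (h ▸ hc a (Finset.mem_insert_self _ _))
    have hneu : b ≠ u := fun h => hab (h ▸ hu a haU)
    have h1 : sInf S ≤ ξ b - ξ c := by
      have := csInf_le hbelow (show |ξ b - ξ c| ∈ S from ⟨b, c, hne, rfl⟩)
      rwa [abs_of_nonneg (by linarith)] at this
    have h2 : ξ b - ξ u ≤ sSup S := by
      have := le_csSup habove (show |ξ b - ξ u| ∈ S from ⟨b, u, hneu, rfl⟩)
      rwa [abs_of_nonneg (by linarith)] at this
    have hpos : 0 < sSup S := by
      have := lt_of_le_of_ne hub (hdist b u hneu).symm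
      linarith
    have h3 := Finset.single_le_sum hterm (Finset.mem_sdiff.2 ⟨haA, haB⟩)
    have h4 : sInf S / sSup S * (ξ b - ξ u) ≤ sInf S := by
      calc _ ≤ sInf S / sSup S * sSup S :=
            mul_le_mul_of_nonneg_left h2 (div_nonneg hinf0 hpos.le)
        _ = sInf S := div_mul_cancel₀ _ hpos.ne'
    have h5 : maxPenObj ξ F (A ∪ B) - maxPenObj ξ F B = ξ b - ξ u := by
      rw [hfu, hfb]; ring
    have h6 : maxPenObj ξ F (insert a B) - maxPenObj ξ F B = ξ b - ξ c := by
      rw [hfc, hfb]; ring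
    rw [h5]
    rw [h6] at h3
    linarith
end

section
/- Suppose D is nonempty. Then f has superadditivity ratio at least ν̌ = (1 − max_{θ ∈ Θ} ξ(θ)) / (|D| · (1 − min_{θ ∈ Θ} ξ(θ))); that is, for every nonempty subset S ⊆ D, f(S) ≥ ν̌ · ∑_{i ∈ S} f({i}). -/
open Finset

theorem stmt5 {Θ D : Type*} [Fintype Θ] [DecidableEq Θ] [Fintype D] [DecidableEq D]
    (hΘ : 2 ≤ Fintype.card Θ) (θp : Θ)
    (F : D → Finset Θ) (hF : ∀ i : D, θp ∈ F i)
    (ξ : Θ → ℝ) (hξ0 : ∀ θ, 0 ≤ ξ θ) (hξ1 : ∀ θ, ξ θ ≤ 1) (hξp : ξ θp = 0)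
    [Nonempty D] :
    ∀ S : Finset D, S.Nonempty →
      maxPenObj ξ F S ≥
        ((1 - sSup (Set.range ξ)) / ((Fintype.card D : ℝ) * (1 - sInf (Set.range ξ)))) *
          ∑ i ∈ S, maxPenObj ξ F {i} := by
  intro S hS
  have hinf : sInf (Set.range ξ) = 0 := by
    apply IsLeast.csInf_eq
    refine ⟨⟨θp, hξp⟩, ?_⟩
    rintro _ ⟨θ, rfl⟩
    exact hξ0 θ
  have hbdd : BddAbove (Set.range ξ) := ⟨1, by rintro _ ⟨θ, rfl⟩; exact hξ1 θ⟩
  have hsup : sSup (Set.range ξ) ≤ 1 := by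
    refine csSup_le (Set.mem_range_self θp |> fun h => ⟨ξ θp, h⟩) ?_
    rintro _ ⟨θ, rfl⟩
    exact hξ1 θ
  have hmem : θp ∈ obsEq F S := by
    unfold obsEq
    rw [Finset.mem_inf]
    exact fun i _ => hF i
  have h1 : 1 - sSup (Set.range ξ) ≤ maxPenObj ξ F S := by
    unfold maxPenObj
    have : sSup (Set.image ξ (↑(obsEq F S) : Set Θ)) ≤ sSup (Set.range ξ) :=
      csSup_le_csSup hbdd ⟨ξ θp, θp, hmem, rfl⟩ (Set.image_subset_range _ _)
    linarith
  have h2 : ∑ i ∈ S, maxPenObj ξ F {i} ≤ (Fintype.card D : ℝ) := by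
    calc ∑ i ∈ S, maxPenObj ξ F {i} ≤ ∑ i ∈ S, (1 : ℝ) := by
          apply Finset.sum_le_sum
          intro i _
          unfold maxPenObj
          have : 0 ≤ sSup (Set.image ξ (↑(obsEq F {i}) : Set Θ)) := by
            apply Real.sSup_nonneg
            rintro _ ⟨θ, _, rfl⟩
            exact hξ0 θ
          linarith
      _ = (S.card : ℝ) := by simp
      _ ≤ (Fintype.card D : ℝ) := by exact_mod_cast Finset.card_le_univ S
  have hD : (0 : ℝ) < Fintype.card D := by exact_mod_cast Fintype.card_pos
  rw [hinf, sub_zero, mul_one]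
  refine le_trans ?_ h1
  rw [div_mul_eq_mul_div, div_le_iff₀ hD]
  exact mul_le_mul_of_nonneg_left h2 (by linarith)
end

section
/- f has bipartite subadditivity ratio at least κ = 2(1 − max_{θ ∈ Θ} ξ(θ)) / (1 − min_{θ ∈ Θ} ξ(θ)); that is, for every subset S ⊆ D and every pair of disjoint sets A, B ⊆ D with A ∪ B = S, f(A) + f(B) ≥ κ · f(S). -/
open Finset

theorem stmt6 {Θ D : Type*} [Fintype Θ] [DecidableEq Θ] [Fintype D] [DecidableEq D]
    (hΘ : 2 ≤ Fintype.card Θ) (θp : Θ)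
    (F : D → Finset Θ) (hF : ∀ i : D, θp ∈ F i)
    (ξ : Θ → ℝ) (hξ0 : ∀ θ, 0 ≤ ξ θ) (hξ1 : ∀ θ, ξ θ ≤ 1) (hξp : ξ θp = 0) :
    ∀ A B : Finset D, Disjoint A B →
      maxPenObj ξ F A + maxPenObj ξ F B ≥
        (2 * (1 - sSup (Set.range ξ)) / (1 - sInf (Set.range ξ))) *
          maxPenObj ξ F (A ∪ B) := by
  intro A B _
  have hb : BddAbove (Set.range ξ) := ⟨1, by rintro _ ⟨θ, rfl⟩; exact hξ1 θ⟩
  have hm : ∀ I : Finset D, θp ∈ obsEq F I := by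
    intro I
    have h : ({θp} : Finset Θ) ≤ I.inf F :=
      Finset.le_inf fun i _ => Finset.singleton_subset_iff.2 (hF i)
    exact Finset.singleton_subset_iff.1 h
  have hinf : sInf (Set.range ξ) = 0 := by
    apply IsLeast.csInf_eq
    exact ⟨⟨θp, hξp⟩, by rintro _ ⟨θ, rfl⟩; exact hξ0 θ⟩
  have hlow : ∀ I : Finset D, 1 - sSup (Set.range ξ) ≤ maxPenObj ξ F I := by
    intro I
    have h := csSup_le_csSup hb (Set.Nonempty.image ξ ⟨θp, Finset.mem_coe.2 (hm I)⟩)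
      (Set.image_subset_range ξ (↑(obsEq F I) : Set Θ))
    unfold maxPenObj
    linarith
  have hup : maxPenObj ξ F (A ∪ B) ≤ 1 := by
    have h : ξ θp ≤ sSup (Set.image ξ (↑(obsEq F (A ∪ B)) : Set Θ)) :=
      le_csSup (hb.mono (Set.image_subset_range _ _))
        (Set.mem_image_of_mem ξ (Finset.mem_coe.2 (hm _)))
    unfold maxPenObj
    linarith
  have hs : sSup (Set.range ξ) ≤ 1 :=
    csSup_le ⟨ξ θp, θp, rfl⟩ (by rintro _ ⟨θ, rfl⟩; exact hξ1 θ)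
  rw [hinf, sub_zero, div_one]
  have hA := hlow A
  have hB := hlow B
  have h3 := mul_le_mul_of_nonneg_left hup (by linarith : 0 ≤ 2 * (1 - sSup (Set.range ξ)))
  linarith
end

section
/- The total-penalty objective g is submodular: for all subsets I₁ ⊆ I₂ ⊆ D and every j ∈ D \ I₂, g(I₁ ∪ {j}) − g(I₁) ≥ g(I₂ ∪ {j}) − g(I₂). -/
open Finset

/-- The total-penalty objective `g(I) = 1 - ∑_{θ ∈ F(I)} ξ(θ)`, where
`F(I) = ⋂_{i ∈ I} F(i)` with `F(∅) = Θ`. -/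
def totPenObj {Θ D : Type*} [Fintype Θ] [DecidableEq Θ]
    (ξ : Θ → ℝ) (F : D → Finset Θ) (I : Finset D) : ℝ :=
  1 - ∑ θ ∈ I.inf F, ξ θ

theorem stmt12 {Θ D : Type*} [Fintype Θ] [DecidableEq Θ] [Fintype D] [DecidableEq D]
    (θp : Θ) (F : D → Finset Θ) (hF : ∀ i : D, θp ∈ F i)
    (ξ : Θ → ℝ) (hξ : ∀ θ, 0 ≤ ξ θ) :
    ∀ I₁ I₂ : Finset D, I₁ ⊆ I₂ → ∀ j : D, j ∉ I₂ →
      totPenObj ξ F (insert j I₁) - totPenObj ξ F I₁ ≥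
        totPenObj ξ F (insert j I₂) - totPenObj ξ F I₂ := by
  have key : ∀ (I : Finset D) (j : D),
      totPenObj ξ F (insert j I) - totPenObj ξ F I = ∑ θ ∈ I.inf F \ F j, ξ θ := by
    intro I j
    have h := Finset.sum_inter_add_sum_sdiff (I.inf F) (F j) ξ
    unfold totPenObj
    rw [Finset.inf_insert, Finset.inf_eq_inter, Finset.inter_comm]
    linarith
  intro I₁ I₂ h j _
  rw [key, key]
  exact Finset.sum_le_sum_of_subset_of_nonneg
    (Finset.sdiff_subset_sdiff (Finset.inf_mono h) (Finset.Subset.refl _))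
    (fun θ _ _ => hξ θ)
end

section
/- The M-RMPIS objective Γ(I) = ∑_{p ∈ Θ} g_p(I) is monotone non-decreasing and submodular: for all I₁ ⊆ I₂ ⊆ D, Γ(I₁) ≤ Γ(I₂), and for all I₁ ⊆ I₂ ⊆ D and j ∈ D \ I₂, Γ(I₁ ∪ {j}) − Γ(I₁) ≥ Γ(I₂ ∪ {j}) − Γ(I₂). -/
open Finset

/-- For each hypothesis `p`, the total-penalty objective
`g_p(I) = 1 - ∑_{θ ∈ F_p(I)} ξ(p, θ)`, where `F_p(I) = ⋂_{i ∈ I} F_p(i)`,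
with `F_p(∅) = Θ`. -/
def totPenObjMat {Θ D : Type*} [Fintype Θ] [DecidableEq Θ]
    (ξ : Θ → Θ → ℝ) (F : Θ → D → Finset Θ) (p : Θ) (I : Finset D) : ℝ :=
  1 - ∑ θ ∈ I.inf (F p), ξ p θ

/-- The M-RMPIS objective `Γ(I) = ∑_{p ∈ Θ} g_p(I)`. -/
def mrmpisObj {Θ D : Type*} [Fintype Θ] [DecidableEq Θ]
    (ξ : Θ → Θ → ℝ) (F : Θ → D → Finset Θ) (I : Finset D) : ℝ :=
  ∑ p : Θ, totPenObjMat ξ F p I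

theorem stmt14 {Θ D : Type*} [Fintype Θ] [DecidableEq Θ] [Fintype D] [DecidableEq D]
    (F : Θ → D → Finset Θ) (hF : ∀ (p : Θ) (i : D), p ∈ F p i)
    (ξ : Θ → Θ → ℝ) (hξ : ∀ p θ, 0 ≤ ξ p θ) :
    (∀ I₁ I₂ : Finset D, I₁ ⊆ I₂ → mrmpisObj ξ F I₁ ≤ mrmpisObj ξ F I₂) ∧
    (∀ I₁ I₂ : Finset D, I₁ ⊆ I₂ → ∀ j : D, j ∉ I₂ →
      mrmpisObj ξ F (insert j I₁) - mrmpisObj ξ F I₁ ≥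
        mrmpisObj ξ F (insert j I₂) - mrmpisObj ξ F I₂) := by
  have gain : ∀ (I : Finset D) (j : D), mrmpisObj ξ F (insert j I) - mrmpisObj ξ F I =
      ∑ p : Θ, ∑ θ ∈ I.inf (F p) \ F p j, ξ p θ := by
    intro I j
    unfold mrmpisObj totPenObjMat
    rw [← Finset.sum_sub_distrib]
    refine Finset.sum_congr rfl fun p _ => ?_
    have h := Finset.sum_inter_add_sum_sdiff (I.inf (F p)) (F p j) (fun θ => ξ p θ)
    rw [Finset.inf_insert, Finset.inf_eq_inter, Finset.inter_comm]
    linarith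
  have anti : ∀ (I₁ I₂ : Finset D), I₁ ⊆ I₂ → ∀ p, I₂.inf (F p) ⊆ I₁.inf (F p) :=
    fun I₁ I₂ h p => Finset.inf_mono h
  refine ⟨fun I₁ I₂ h => ?_, fun I₁ I₂ h j _ => ?_⟩
  · unfold mrmpisObj totPenObjMat
    refine Finset.sum_le_sum fun p _ => ?_
    exact sub_le_sub_left
      (Finset.sum_le_sum_of_subset_of_nonneg (anti I₁ I₂ h p) fun θ _ _ => hξ p θ) 1
  · rw [gain, gain, ge_iff_le]
    refine Finset.sum_le_sum fun p _ => ?_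
    exact Finset.sum_le_sum_of_subset_of_nonneg
      (Finset.sdiff_subset_sdiff (anti I₁ I₂ h p) (Finset.Subset.refl _)) fun θ _ _ => hξ p θ
end
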